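/- Gaussian comparison over rectangles (Lemma E.3). Let G and V be centered Gaussian random vectors in R^p with p ≥ 2, with covariance matrices Σ^G = (Σ^G_{jk}) and Σ^V = (Σ^V_{jk}) respectively, and let Δ = max_{1≤j,k≤p} |Σ^G_{jk} − Σ^V_{jk}|. Suppose that min_{1≤j≤p} Σ^G_{jj} ≥ σ̲² and min_{1≤j≤p} Σ^V_{jj} ≥ σ̲² for some constant σ̲ > 0. Then sup_{A ∈ 𝒜} |P(G ∈ A) − P(V ∈ A)| ≤ C Δ^{1/3} (log p)^{2/3}, where 𝒜 = {∏_{j=1}^p [a_j, b_j] : −∞ ≤ a_j ≤ b_j ≤ ∞} is the collection of closed rectangles in R^p and C is a constant depending only on σ̲. -/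

import Mathlib

open MeasureTheory ProbabilityTheory

noncomputable section

/-- Closed (possibly unbounded) axis-aligned rectangle `∏_j [a j, b j]` in `ℝ^p`,
with endpoints in the extended reals. -/
def gaussRect {p : ℕ} (a b : Fin p → EReal) : Set (Fin p → ℝ) :=
  {x | ∀ j, a j ≤ (x j : EReal) ∧ (x j : EReal) ≤ b j}

/-- `ν` is the law of a centered Gaussian random vector in `ℝ^p` with covariance matrix `C`:
every linear functional has the corresponding centered one-dimensional normal law. -/
def IsCenteredGaussianCov {p : ℕ} (ν : Measure (Fin p → ℝ)) (C : Fin p → Fin p → ℝ) : Prop :=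
  IsProbabilityMeasure ν ∧
    ∀ t : Fin p → ℝ,
      ν.map (fun x => ∑ j, t j * x j) =
        gaussianReal 0 (Real.toNNReal (∑ j, ∑ k, t j * C j k * t k))


/-- `ν` is a centered Gaussian law with covariance matrix `S`. -/
structure CG {ι : Type} [Fintype ι] (ν : Measure (ι → ℝ)) (S : ι → ι → ℝ) : Prop where
  gauss : IsGaussian ν
  mean : ∀ i, ∫ x, x i ∂ν = 0
  cov : ∀ i j, cov[fun x => x i, fun x => x j; ν] = S i j

section
variable {ι : Type} [Fintype ι] {ν : Measure (ι → ℝ)} {S : ι → ι → ℝ}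

lemma CG.memLp (h : CG ν S) (i : ι) : MemLp (fun x : ι → ℝ => x i) 2 ν := by
  have := h.gauss
  exact IsGaussian.memLp_dual ν (ContinuousLinearMap.proj (R := ℝ) (φ := fun _ : ι => ℝ) i) 2 (by simp)

lemma CG.integrable (h : CG ν S) (i : ι) : Integrable (fun x : ι → ℝ => x i) ν := by
  have := h.gauss
  exact (h.memLp i).integrable (by norm_num)

lemma CG.symm (h : CG ν S) (i j : ι) : S i j = S j i := by
  rw [← h.cov, ← h.cov, covariance_comm]

lemma CG.marginal (h : CG ν S) (i : ι) :
    ν.map (fun x => x i) = gaussianReal 0 (S i i).toNNReal := by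
  have := h.gauss
  have h1 := IsGaussian.map_eq_gaussianReal (μ := ν)
    (ContinuousLinearMap.proj (R := ℝ) (φ := fun _ : ι => ℝ) i)
  have h2 := h.cov i i
  rw [covariance_self (measurable_pi_apply i).aemeasurable] at h2
  have h3 := h.mean i
  change ν.map (fun x => x i) = gaussianReal (∫ x, x i ∂ν) (Var[fun x => x i; ν]).toNNReal at h1
  rw [h1, h2, h3]

lemma CG.decomp (h : CG ν S) (j : ι) (hj : S j j ≠ 0) :
    ν.map (fun x => (x j, fun k => x k - x j * (S j k / S j j))) =
      (gaussianReal 0 (S j j).toNNReal).prod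
        (ν.map (fun x k => x k - x j * (S j k / S j j))) := by
  have := h.gauss
  have hind : IndepFun (fun (x : ι → ℝ) (_ : Unit) => x j)
      (fun (x : ι → ℝ) k => x k - x j * (S j k / S j j)) ν := by
    refine HasGaussianLaw.indepFun_of_covariance_eval (X := fun (_ : Unit) (x : ι → ℝ) => x j)
      (Y := fun k x => x k - x j * (S j k / S j j)) ?_ ?_
    · let P : ι → (ι → ℝ) →L[ℝ] ℝ := fun i =>
        (ContinuousLinearMap.proj (R := ℝ) (φ := fun _ : ι => ℝ) i)
      let T : (ι → ℝ) →L[ℝ] ((Unit → ℝ) × (ι → ℝ)) :=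
        (ContinuousLinearMap.pi fun _ => P j).prod
          (ContinuousLinearMap.pi fun k => P k - (S j k / S j j) • P j)
      constructor
      have : (fun x : ι → ℝ => ((fun (_ : Unit) => x j), fun k => x k - x j * (S j k / S j j))) = T := by
        funext x
        simp [T, P, mul_comm]
      rw [this]
      infer_instance
    · intro _ k
      have e : (fun x : ι → ℝ => x k - x j * (S j k / S j j)) =
        (fun x => x k) - fun x => x j * (S j k / S j j) := rfl
      rw [e, covariance_sub_right (h.memLp j) (h.memLp k) ((h.memLp j).mul_const _),
        covariance_mul_const_right, h.cov, h.cov]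
      field_simp
      simp
  have hmu : Measurable (fun f : Unit → ℝ => f ()) := measurable_pi_apply ()
  have hmi : Measurable (fun f : ι → ℝ => f) := measurable_id
  have hind2 := hind.comp hmu hmi
  have := (indepFun_iff_map_prod_eq_prod_map_map (Measurable.aemeasurable (by fun_prop))
    (Measurable.aemeasurable (by fun_prop))).1 hind2
  simp only [Function.comp_def, id] at this
  rw [this, h.marginal]

/-- Pushforward under a linear map sending each coordinate to a multiple of a coordinate. -/
lemma CG.push (h : CG ν S) {κ : Type} [Fintype κ] (s : κ → ℝ) (m : κ → ι) :
    CG (ν.map (fun x k => s k * x (m k))) (fun k l => s k * s l * S (m k) (m l)) := by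
  have := h.gauss
  have hm : Measurable (fun (x : ι → ℝ) k => s k * x (m k)) := by fun_prop
  constructor
  · let P : ι → (ι → ℝ) →L[ℝ] ℝ := fun i =>
        (ContinuousLinearMap.proj (R := ℝ) (φ := fun _ : ι => ℝ) i)
    let T : (ι → ℝ) →L[ℝ] (κ → ℝ) := ContinuousLinearMap.pi fun k => s k • P (m k)
    have : (fun (x : ι → ℝ) k => s k * x (m k)) = T := by
      funext x
      simp [T, P]
    rw [this]; infer_instance
  · intro k
    rw [integral_map hm.aemeasurable (measurable_pi_apply k).aestronglyMeasurable]
    rw [integral_const_mul, h.mean, mul_zero]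
  · intro k l
    rw [covariance_map (measurable_pi_apply k).aestronglyMeasurable
      (measurable_pi_apply l).aestronglyMeasurable hm.aemeasurable]
    simp only [Function.comp_def]
    rw [covariance_const_mul_left, covariance_const_mul_right, h.cov]
    ring

end

lemma cg_of_isCenteredGaussianCov {p : ℕ} {ν : Measure (Fin p → ℝ)} {C : Fin p → Fin p → ℝ}
    (h : IsCenteredGaussianCov ν C) (hC : ∀ j, 0 < C j j) :
    CG ν (fun j k => (C j k + C k j) / 2) := by
  obtain ⟨hp, h⟩ := h
  have hrepr : ∀ L : (Fin p → ℝ) →L[ℝ] ℝ, (L : (Fin p → ℝ) → ℝ) =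
      fun x => ∑ j, L (Pi.single j 1) * x j := by
    intro L; funext x
    conv_lhs => rw [← Finset.univ_sum_single x, map_sum]
    refine Finset.sum_congr rfl fun j _ => ?_
    have : (Pi.single j (x j) : Fin p → ℝ) = x j • Pi.single j 1 := by
      rw [← Pi.single_smul]; simp
    simp [this, mul_comm]
  have hg : IsGaussian ν := by
    refine isGaussian_of_map_eq_gaussianReal fun L => ?_
    rw [hrepr L, h]
    exact ⟨_, _, rfl⟩
  have hvar : ∀ t : Fin p → ℝ, Var[fun x => ∑ j, t j * x j; ν] =
      max (∑ j, ∑ k, t j * C j k * t k) 0 := by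
    intro t
    have : Var[id; ν.map (fun x => ∑ j, t j * x j)] = Var[fun x => ∑ j, t j * x j; ν] := by
      rw [variance_map (by fun_prop) (Measurable.aemeasurable (by fun_prop))]; rfl
    rw [← this, h, variance_id_gaussianReal, Real.coe_toNNReal']
  have hmean : ∀ i, ∫ x, x i ∂ν = 0 := by
    intro i
    have h1 := h (Pi.single i 1)
    have e : (fun x : Fin p → ℝ => ∑ j, (Pi.single i 1 : Fin p → ℝ) j * x j) = fun x => x i := by
      funext x; simp [Pi.single_apply]
    rw [e] at h1
    have : ∫ y, y ∂(ν.map (fun x => x i)) = ∫ x, x i ∂ν := by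
      rw [integral_map (measurable_pi_apply i).aemeasurable (by fun_prop)]
    rw [← this, h1, integral_id_gaussianReal]
  have hL : ∀ i, MemLp (fun x : Fin p → ℝ => x i) 2 ν := fun i =>
    IsGaussian.memLp_dual ν (ContinuousLinearMap.proj (R := ℝ) (φ := fun _ : Fin p => ℝ) i) 2 (by simp)
  refine ⟨hg, hmean, fun i j => ?_⟩
  -- two-coordinate computation
  have hq : ∀ a b : ℝ, a ^ 2 * Var[fun x => x i; ν] + 2 * a * b * cov[fun x => x i, fun x => x j; ν]
      + b ^ 2 * Var[fun x => x j; ν] =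
      max (a ^ 2 * C i i + a * b * (C i j + C j i) + b ^ 2 * C j j) 0 := by
    intro a b
    have h1 := hvar (a • Pi.single i 1 + b • Pi.single j 1)
    have e : (fun x : Fin p → ℝ => ∑ k, (a • Pi.single i 1 + b • Pi.single j 1 : Fin p → ℝ) k * x k) =
      (fun x => a * x i) + fun x => b * x j := by
      funext x
      simp [add_mul, Finset.sum_add_distrib, Pi.single_apply]
    rw [e, variance_add ((hL i).const_mul a) ((hL j).const_mul b), variance_const_mul,
      variance_const_mul, covariance_const_mul_left, covariance_const_mul_right] at h1
    rw [show a ^ 2 * Var[fun x => x i; ν] + 2 * a * b * cov[fun x => x i, fun x => x j; ν]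
      + b ^ 2 * Var[fun x => x j; ν] = a ^ 2 * Var[fun x => x i; ν] +
      2 * (a * (b * cov[fun x => x i, fun x => x j; ν]))
      + b ^ 2 * Var[fun x => x j; ν] by ring, h1]
    congr 1
    simp only [Pi.add_apply, Pi.smul_apply, smul_eq_mul, add_mul, mul_add, Finset.sum_add_distrib,
      Pi.single_apply]
    simp
    ring
  have hi := hq 1 0
  have hj := hq 0 1
  simp only [one_pow, one_mul, mul_zero, zero_mul, add_zero, ne_eq, OfNat.ofNat_ne_zero,
    not_false_eq_true, zero_pow, mul_one, zero_add] at hi hj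
  rw [max_eq_left (hC i).le] at hi
  rw [max_eq_left (hC j).le] at hj
  -- choose a small b
  set D := C i j + C j i with hD
  have hden : 0 < |D| + 1 := by positivity
  have h3 := hq 1 (C i i / (|D| + 1))
  have hb : 0 < C i i / (|D| + 1) := div_pos (hC i) hden
  set b := C i i / (|D| + 1) with hbdef
  have hbm : b * (|D| + 1) = C i i := by rw [hbdef]; field_simp
  rw [max_eq_left, hi, hj] at h3
  · have : b * (2 * cov[fun x => x i, fun x => x j; ν]) = b * D := by linarith
    have := mul_left_cancel₀ hb.ne' this
    linarith
  · have := neg_abs_le D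
    nlinarith [hC j, hC i, sq_nonneg b, mul_nonneg hb.le (by linarith : 0 ≤ D + |D|),
      mul_nonneg (sq_nonneg b) (hC j).le]


section
variable {ι : Type} [Fintype ι] {ν : Measure (ι → ℝ)} {S : ι → ι → ℝ}

/-- tie-broken argmax condition, written in the coordinates `(s, r)`. -/
def nzSet (c u : ι → ℝ) (j : ι) : Set (ℝ × (ι → ℝ)) :=
  {z | ∀ k, k ≠ j → (z.2 k + z.1 * u k - c k ≤ z.1 - c j ∧
    (Fintype.equivFin ι k < Fintype.equivFin ι j → z.2 k + z.1 * u k - c k < z.1 - c j))}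

lemma nzSet_meas (c u : ι → ℝ) (j : ι) : MeasurableSet (nzSet c u j) := by
  unfold nzSet
  refine measurableSet_setOfPred.2 ?_
  refine Measurable.forall fun k => Measurable.imp measurable_const (Measurable.and ?_ (Measurable.imp measurable_const ?_))
  · exact measurableSet_setOfPred.1 (measurableSet_le (by fun_prop) (by fun_prop))
  · exact measurableSet_setOfPred.1 (measurableSet_lt (by fun_prop) (by fun_prop))

/-- tie-broken argmax region. -/
def nzA (c : ι → ℝ) (j : ι) : Set (ι → ℝ) :=
  {x | ∀ k, k ≠ j → (x k - c k ≤ x j - c j ∧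
    (Fintype.equivFin ι k < Fintype.equivFin ι j → x k - c k < x j - c j))}

def nzD (c : ι → ℝ) (j : ι) (I : Set ℝ) : Set (ι → ℝ) := nzA c j ∩ {x | x j - c j ∈ I}

lemma nzD_meas (c : ι → ℝ) (j : ι) (I : Set ℝ) (hI : MeasurableSet I) :
    MeasurableSet (nzD c j I) := by
  refine MeasurableSet.inter ?_ ?_
  · unfold nzA
    refine measurableSet_setOfPred.2 ?_
    refine Measurable.forall fun k => Measurable.imp measurable_const (Measurable.and ?_ (Measurable.imp measurable_const ?_))
    · exact measurableSet_setOfPred.1 (measurableSet_le (by fun_prop) (by fun_prop))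
    · exact measurableSet_setOfPred.1 (measurableSet_lt (by fun_prop) (by fun_prop))
  · exact (show Measurable fun x : ι → ℝ => x j - c j by fun_prop) hI

lemma nzA_disj (c : ι → ℝ) : Pairwise (Function.onFun Disjoint (nzA c)) := by
  intro i j hij
  refine Set.disjoint_left.2 fun x hi hj => ?_
  have h1 := hi j hij.symm
  have h2 := hj i hij
  have hne : Fintype.equivFin ι i ≠ Fintype.equivFin ι j := fun h => hij ((Fintype.equivFin ι).injective h)
  rcases lt_or_gt_of_ne hne with h | h
  · have := h2.2 h; linarith [h1.1]
  · have := h1.2 h; linarith [h2.1]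

lemma nzA_exists [Nonempty ι] (c x : ι → ℝ) : ∃ j, x ∈ nzA c j ∧ ∀ i, x i - c i ≤ x j - c j := by
  obtain ⟨j, -, hj⟩ := Finset.exists_max_image (Finset.univ : Finset ι)
    (fun k => toLex (x k - c k, OrderDual.toDual (Fintype.equivFin ι k))) Finset.univ_nonempty
  have key : ∀ k, x k - c k < x j - c j ∨
      (x k - c k = x j - c j ∧ Fintype.equivFin ι j ≤ Fintype.equivFin ι k) := by
    intro k
    have := hj k (Finset.mem_univ _)
    rw [Prod.Lex.toLex_le_toLex] at this
    simpa using this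
  refine ⟨j, fun k _ => ⟨?_, fun hk => ?_⟩, fun i => ?_⟩
  · rcases key k with h | h
    · exact h.le
    · exact h.1.le
  · rcases key k with h | h
    · exact h
    · exact absurd hk (not_lt.2 h.2)
  · rcases key i with h | h
    · exact h.le
    · exact h.1.le

/-- the residual law -/
def nzR (ν : Measure (ι → ℝ)) (S : ι → ι → ℝ) (j : ι) : Measure (ι → ℝ) :=
  ν.map (fun x k => x k - x j * (S j k / S j j))

def nzq (ν : Measure (ι → ℝ)) (S : ι → ι → ℝ) (c : ι → ℝ) (j : ι) (t : ℝ) : ENNReal :=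
  nzR ν S j (Prod.mk (c j + t) ⁻¹' nzSet c (fun k => S j k / S j j) j)

def nzg (ν : Measure (ι → ℝ)) (S : ι → ι → ℝ) (c : ι → ℝ) (j : ι) (t : ℝ) : ENNReal :=
  gaussianPDF 0 1 (c j + t) * nzq ν S c j t

lemma nzR_prob (h : CG ν S) (j : ι) : IsProbabilityMeasure (nzR ν S j) := by
  have := h.gauss
  exact Measure.isProbabilityMeasure_map (Measurable.aemeasurable (by fun_prop))

lemma nzq_meas (h : CG ν S) (c : ι → ℝ) (j : ι) : Measurable (nzq ν S c j) := by
  have := nzR_prob h j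
  have h1 := measurable_measure_prodMk_left (ν := nzR ν S j)
    (nzSet_meas c (fun k => S j k / S j j) j)
  exact h1.comp (measurable_const_add (c j))

lemma nzg_meas (h : CG ν S) (c : ι → ℝ) (j : ι) : Measurable (nzg ν S c j) := by
  refine Measurable.mul ?_ (nzq_meas h c j)
  exact (measurable_gaussianPDF 0 1).comp (measurable_const_add (c j))

lemma nzD_eq (h : CG ν S) (hS : ∀ i, S i i = 1) (c : ι → ℝ) (j : ι) (I : Set ℝ)
    (hI : MeasurableSet I) :
    ν (nzD c j I) = ∫⁻ t in I, nzg ν S c j t := by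
  have := nzR_prob h j
  have := h.gauss
  set u : ι → ℝ := fun k => S j k / S j j with hu
  set B : Set (ℝ × (ι → ℝ)) := nzSet c u j ∩ {z | z.1 - c j ∈ I} with hB
  have hBm : MeasurableSet B := (nzSet_meas c u j).inter
    ((show Measurable fun z : ℝ × (ι → ℝ) => z.1 - c j by fun_prop) hI)
  have hpre : nzD c j I = (fun x : ι → ℝ => (x j, fun k => x k - x j * (S j k / S j j))) ⁻¹' B := by
    ext x
    simp [nzD, nzA, hB, nzSet, hu]
  have hm : Measurable (fun x : ι → ℝ => (x j, fun k => x k - x j * (S j k / S j j))) := by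
    fun_prop
  have hv : (S j j).toNNReal = 1 := by rw [hS, Real.toNNReal_one]
  rw [hpre, ← Measure.map_apply hm hBm, h.decomp j (by rw [hS]; norm_num), Measure.prod_apply hBm,
    hv, gaussianReal_of_var_ne_zero _ one_ne_zero,
    lintegral_withDensity_eq_lintegral_mul _ (measurable_gaussianPDF 0 1)
      (measurable_measure_prodMk_left hBm),
    ← lintegral_add_left_eq_self _ (c j), ← lintegral_indicator hI]
  refine lintegral_congr fun t => ?_
  by_cases ht : t ∈ I
  · rw [Set.indicator_of_mem ht]
    have hsl : Prod.mk (c j + t) ⁻¹' B = Prod.mk (c j + t) ⁻¹' nzSet c u j := by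
      ext r; simp [hB, ht]
    simp only [Pi.mul_apply, nzg, nzq, nzR, hsl, hu]
  · rw [Set.indicator_of_notMem ht]
    have : Prod.mk (c j + t) ⁻¹' B = ∅ := by
      ext r; simp [hB, ht]
    simp [this]

lemma cov_le_one (h : CG ν S) (hS : ∀ i, S i i = 1) (j k : ι) : S j k ≤ 1 := by
  have := h.gauss
  have h1 := variance_nonneg ((fun x : ι → ℝ => x j) - fun x => x k) ν
  rw [variance_sub (h.memLp j) (h.memLp k)] at h1
  have a := h.cov j j
  have b := h.cov k k
  rw [covariance_self (measurable_pi_apply _).aemeasurable, hS] at a b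
  rw [a, b, h.cov] at h1
  linarith

lemma nzq_mono (h : CG ν S) (hS : ∀ i, S i i = 1) (c : ι → ℝ) (j : ι) : Monotone (nzq ν S c j) := by
  intro t t' htt
  refine measure_mono fun r hr k hk => ?_
  obtain ⟨h1, h2⟩ := hr k hk
  have hu := cov_le_one h hS j k
  simp only [hS, div_one] at h1 h2 ⊢
  have : 0 ≤ (t' - t) * (1 - S j k) := mul_nonneg (by linarith) (by linarith)
  refine ⟨by nlinarith, fun hlt => ?_⟩
  have := h2 hlt
  nlinarith

lemma nzq_le_one (h : CG ν S) (c : ι → ℝ) (j : ι) (t : ℝ) : nzq ν S c j t ≤ 1 := by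
  have := nzR_prob h j
  exact prob_le_one

lemma pdf_eq (x : ℝ) : gaussianPDFReal 0 1 x = (√(2 * Real.pi))⁻¹ * Real.exp (-x ^ 2 / 2) := by
  simp [gaussianPDFReal]

lemma nzg_step (h : CG ν S) (hS : ∀ i, S i i = 1) (c : ι → ℝ) (j : ι) (L : ℝ) (hL : 1 ≤ L)
    (t s : ℝ) (hs : 0 ≤ s) (hs2 : s ≤ 1 / √(2 * L)) :
    nzg ν S c j t ≤ ENNReal.ofReal (Real.exp (-L)) +
      ENNReal.ofReal (Real.exp (3 / 2)) * nzg ν S c j (t + s) := by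
  set l := √(2 * L) with hl
  have hll : l ^ 2 = 2 * L := Real.sq_sqrt (by linarith)
  have hl1 : 1 ≤ l := by
    rw [hl]; exact Real.one_le_sqrt.2 (by linarith)
  have hpi : (√(2 * Real.pi))⁻¹ ≤ 1 := by
    refine inv_le_one_of_one_le₀ (Real.one_le_sqrt.2 ?_)
    linarith [Real.pi_gt_three]
  by_cases hc : l < c j + t
  · refine le_add_right ?_
    unfold nzg
    calc _ ≤ gaussianPDF 0 1 (c j + t) * 1 := by gcongr; exact nzq_le_one h c j t
      _ ≤ _ := by
        rw [mul_one, gaussianPDF, pdf_eq]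
        apply ENNReal.ofReal_le_ofReal
        calc _ ≤ 1 * Real.exp (-L) := by
              gcongr
              nlinarith
          _ = _ := one_mul _
  · push Not at hc
    refine le_add_left ?_
    unfold nzg
    rw [← mul_assoc]
    gcongr
    · rw [gaussianPDF, gaussianPDF, ← ENNReal.ofReal_mul (by positivity), pdf_eq, pdf_eq]
      apply ENNReal.ofReal_le_ofReal
      rw [mul_left_comm, ← Real.exp_add]
      gcongr
      have h1 : s * l ≤ 1 := by
        rw [le_div_iff₀ (by linarith)] at hs2; exact hs2
      have h2 : s ≤ 1 := hs2.trans (by rw [div_le_one (by linarith)]; exact hl1)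
      nlinarith [mul_le_mul_of_nonneg_left hc hs]
    · exact nzq_mono h hS c j (by linarith)

lemma nzg_sum (h : CG ν S) (hS : ∀ i, S i i = 1) (c : ι → ℝ) (L : ℝ) (hL : 1 ≤ L)
    (hn : (Fintype.card ι : ℝ) ≤ Real.exp L) (t : ℝ) :
    ∑ j, nzg ν S c j t ≤ ENNReal.ofReal (10 * √L) := by
  have := h.gauss
  set l := √(2 * L) with hl
  have hl1 : 1 ≤ l := by
    rw [hl]; exact Real.one_le_sqrt.2 (by linarith)
  have hl0 : 0 < l := by linarith
  have step : ∀ j, nzg ν S c j t * ENNReal.ofReal (1 / l) ≤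
      ENNReal.ofReal (Real.exp (-L)) * ENNReal.ofReal (1 / l) +
        ENNReal.ofReal (Real.exp (3 / 2)) * ν (nzD c j (Set.Ioc t (t + 1 / l))) := by
    intro j
    have hmeas : Measurable fun s => nzg ν S c j (t + s) := (nzg_meas h c j).comp (measurable_const_add t)
    calc nzg ν S c j t * ENNReal.ofReal (1 / l) = ∫⁻ s in Set.Ioc 0 (1 / l), nzg ν S c j t := by
          simp
      _ ≤ ∫⁻ s in Set.Ioc 0 (1 / l), (ENNReal.ofReal (Real.exp (-L)) +
            ENNReal.ofReal (Real.exp (3 / 2)) * nzg ν S c j (t + s)) := by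
          refine setLIntegral_mono' measurableSet_Ioc fun s hs => ?_
          exact nzg_step h hS c j L hL t s hs.1.le hs.2
      _ = ENNReal.ofReal (Real.exp (-L)) * ENNReal.ofReal (1 / l) +
          ENNReal.ofReal (Real.exp (3 / 2)) * ∫⁻ s in Set.Ioc 0 (1 / l), nzg ν S c j (t + s) := by
          rw [lintegral_add_left (by fun_prop), lintegral_const_mul _ hmeas]
          simp
      _ = _ := by
          congr 2
          rw [nzD_eq h hS c j _ measurableSet_Ioc, ← lintegral_indicator measurableSet_Ioc,
            ← lintegral_indicator measurableSet_Ioc, ← lintegral_add_left_eq_self (Set.indicator (Set.Ioc t (t + 1 / l)) _) t]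
          refine lintegral_congr fun s => ?_
          simp [Set.indicator_apply]
  have hsum : (∑ j, nzg ν S c j t) * ENNReal.ofReal (1 / l) ≤
      ENNReal.ofReal (1 / l) + ENNReal.ofReal (Real.exp (3 / 2)) := by
    rw [Finset.sum_mul]
    calc _ ≤ ∑ j, (ENNReal.ofReal (Real.exp (-L)) * ENNReal.ofReal (1 / l) +
        ENNReal.ofReal (Real.exp (3 / 2)) * ν (nzD c j (Set.Ioc t (t + 1 / l)))) :=
          Finset.sum_le_sum fun j _ => step j
      _ ≤ _ := by
        rw [Finset.sum_add_distrib, Finset.sum_const, nsmul_eq_mul, ← mul_assoc, ← Finset.mul_sum]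
        gcongr
        · refine mul_le_of_le_one_left' ?_
          rw [Finset.card_univ, ← ENNReal.ofReal_natCast, ← ENNReal.ofReal_mul (by positivity)]
          rw [ENNReal.ofReal_le_one, Real.exp_neg]
          exact mul_inv_le_one_of_le₀ hn (by positivity)
        · refine mul_le_of_le_one_right' ?_
          rw [← measure_biUnion_finset]
          · exact prob_le_one
          · intro i _ j _ hij
            exact (nzA_disj c hij).mono Set.inter_subset_left Set.inter_subset_left
          · intro j _
            exact nzD_meas c j _ measurableSet_Ioc
  have hfin : ∑ j, nzg ν S c j t = (∑ j, nzg ν S c j t) * ENNReal.ofReal (1 / l) * ENNReal.ofReal l := by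
    rw [mul_assoc, ← ENNReal.ofReal_mul (by positivity)]
    rw [one_div_mul_cancel hl0.ne', ENNReal.ofReal_one, mul_one]
  rw [hfin]
  calc _ ≤ (ENNReal.ofReal (1 / l) + ENNReal.ofReal (Real.exp (3 / 2))) * ENNReal.ofReal l := by gcongr
    _ = ENNReal.ofReal (1 + Real.exp (3 / 2) * l) := by
      rw [← ENNReal.ofReal_add (by positivity) (by positivity), ← ENNReal.ofReal_mul (by positivity)]
      congr 1
      field_simp
    _ ≤ _ := by
      apply ENNReal.ofReal_le_ofReal
      have e1 : Real.exp (3 / 2) ≤ 5 := by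
        have : Real.exp (3/2) ^ 2 = Real.exp 1 ^ 3 := by
          rw [← Real.exp_nat_mul, ← Real.exp_nat_mul]; norm_num
        have h1 := Real.exp_one_lt_d9
        have h3 : Real.exp 1 ^ 3 ≤ 2.72 ^ 3 := by
          gcongr; linarith
        nlinarith [Real.exp_pos (3/2)]
      have e2 : l = √2 * √L := by rw [hl, Real.sqrt_mul (by norm_num)]
      have e3 : √2 ≤ 1.5 := by
        rw [Real.sqrt_le_left (by norm_num)]; norm_num
      have e4 : 1 ≤ √L := Real.one_le_sqrt.2 hL
      have e5 : l ≤ 1.5 * √L := by rw [e2]; gcongr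
      nlinarith [mul_le_mul e1 e5 hl0.le (by norm_num)]

lemma nazarov1 [Nonempty ι] (h : CG ν S) (hS : ∀ i, S i i = 1) (c : ι → ℝ) (L : ℝ) (hL : 1 ≤ L)
    (hn : (Fintype.card ι : ℝ) ≤ Real.exp L) (η : ℝ) (hη : 0 ≤ η) :
    ν.real {x | ∀ i, x i ≤ c i + η} ≤ ν.real {x | ∀ i, x i ≤ c i} + 10 * √L * η := by
  have := h.gauss
  have hsub : {x : ι → ℝ | ∀ i, x i ≤ c i + η} ⊆ {x | ∀ i, x i ≤ c i} ∪ ⋃ j, nzD c j (Set.Ioc 0 η) := by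
    intro x hx
    by_cases hx2 : ∀ i, x i ≤ c i
    · exact Or.inl hx2
    · right
      push Not at hx2
      obtain ⟨i, hi⟩ := hx2
      obtain ⟨j, hj, hmax⟩ := nzA_exists c x
      refine Set.mem_iUnion.2 ⟨j, hj, ?_, ?_⟩
      · linarith [hmax i]
      · linarith [hx j]
  have h2 : ν (⋃ j, nzD c j (Set.Ioc 0 η)) ≤ ENNReal.ofReal (10 * √L * η) := by
    calc _ ≤ ∑ j, ν (nzD c j (Set.Ioc 0 η)) := measure_iUnion_fintype_le _ _
      _ = ∑ j, ∫⁻ t in Set.Ioc 0 η, nzg ν S c j t := by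
        refine Finset.sum_congr rfl fun j _ => nzD_eq h hS c j _ measurableSet_Ioc
      _ = ∫⁻ t in Set.Ioc 0 η, ∑ j, nzg ν S c j t := by
        rw [lintegral_finsetSum _ (fun j _ => nzg_meas h c j)]
      _ ≤ ∫⁻ t in Set.Ioc 0 η, ENNReal.ofReal (10 * √L) :=
        lintegral_mono fun t => nzg_sum h hS c L hL hn t
      _ = _ := by
        simp [ENNReal.ofReal_mul]
  have h3 : ν.real (⋃ j, nzD c j (Set.Ioc 0 η)) ≤ 10 * √L * η :=
    ENNReal.toReal_le_of_le_ofReal (by positivity) h2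
  calc _ ≤ _ := measureReal_mono hsub
    _ ≤ _ := measureReal_union_le _ _
    _ ≤ _ := by gcongr

lemma nazarov [Nonempty ι] (h : CG ν S) (σ : ℝ) (hσ : 0 < σ) (hS : ∀ i, σ ^ 2 ≤ S i i) (c : ι → ℝ)
    (L : ℝ) (hL : 1 ≤ L)
    (hn : (Fintype.card ι : ℝ) ≤ Real.exp L) (η : ℝ) (hη : 0 ≤ η) :
    ν.real {x | ∀ i, x i ≤ c i + η} ≤ ν.real {x | ∀ i, x i ≤ c i} + 10 * √L * (η / σ) := by
  have := h.gauss
  have hpos : ∀ i, 0 < S i i := fun i => lt_of_lt_of_le (by positivity) (hS i)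
  have hsq : ∀ i, σ ≤ √(S i i) := fun i => Real.le_sqrt_of_sq_le (hS i)
  have hpush := h.push (fun i => (√(S i i))⁻¹) id
  have key := nazarov1 hpush (fun i => by
    have := Real.mul_self_sqrt (hpos i).le
    have h0 : √(S i i) ≠ 0 := (Real.sqrt_pos.2 (hpos i)).ne'
    simp only [id]
    field_simp
    rw [sq]; exact this.symm) (fun i => (√(S i i))⁻¹ * c i) L hL hn (η / σ) (by positivity)
  have hm : Measurable (fun (x : ι → ℝ) k => (√(S k k))⁻¹ * x (id k)) := by fun_prop
  have hset : ∀ d : ι → ℝ, MeasurableSet {x : ι → ℝ | ∀ i, x i ≤ d i} := fun d =>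
    measurableSet_setOfPred.2 (Measurable.forall fun k => measurableSet_setOfPred.1
      (measurableSet_le (by fun_prop) (by fun_prop)))
  rw [map_measureReal_apply hm (hset _), map_measureReal_apply hm (hset _)] at key
  have e1 : (fun (x : ι → ℝ) k => (√(S k k))⁻¹ * x (id k)) ⁻¹' {x | ∀ i, x i ≤ (√(S i i))⁻¹ * c i}
      = {x | ∀ i, x i ≤ c i} := by
    ext x
    simp only [Set.mem_preimage, Set.mem_ofPred_eq, id]
    refine forall_congr' fun i => ?_
    exact mul_le_mul_iff_right₀ (by have := Real.sqrt_pos.2 (hpos i); positivity)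
  rw [e1] at key
  refine le_trans (measureReal_mono ?_) key
  intro x hx i
  have h1 : (√(S i i))⁻¹ * η ≤ η / σ := by
    rw [div_eq_inv_mul]
    gcongr
    exact hsq i
  have h2 : (√(S i i))⁻¹ * x i ≤ (√(S i i))⁻¹ * (c i + η) := by
    gcongr
    exact hx i
  simp only [id]
  linarith
end


lemma pdf_integrable_mul {v : NNReal} (hv : v ≠ 0) {h : ℝ → ℝ} :
    Integrable h (gaussianReal 0 v) ↔ Integrable (fun s => gaussianPDFReal 0 v s * h s) := by
  rw [gaussianReal_of_var_ne_zero _ hv, integrable_withDensity_iff_integrable_smul'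
    (measurable_gaussianPDF 0 v) (by simp [gaussianPDF_lt_top])]
  simp

lemma ibp1 {v : NNReal} (hv : v ≠ 0) (h h' : ℝ → ℝ) (hd : ∀ s, HasDerivAt h (h' s) s) (M : ℝ)
    (hM : ∀ s, |h s| ≤ M) (hM' : ∀ s, |h' s| ≤ M) (hc : Continuous h') :
    ∫ s, s * h s ∂(gaussianReal 0 v) = v * ∫ s, h' s ∂(gaussianReal 0 v) := by
  have hv0 : (v : ℝ) ≠ 0 := by exact_mod_cast hv
  have hhc : Continuous h := continuous_iff_continuousAt.2 fun s => (hd s).continuousAt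
  rw [integral_gaussianReal_eq_integral_smul hv, integral_gaussianReal_eq_integral_smul hv]
  have hpdf : ∀ s, HasDerivAt (gaussianPDFReal 0 v) (-(s / v) * gaussianPDFReal 0 v s) s := by
    intro s
    unfold gaussianPDFReal
    have h1 : HasDerivAt (fun x : ℝ => -(x - 0) ^ 2 / (2 * v)) (-(s / v)) s := by
      have := (((hasDerivAt_id s).sub_const 0).pow 2).neg.div_const (2 * (v : ℝ))
      refine this.congr_deriv ?_
      simp
      field_simp
    have h2 := h1.exp.const_mul (√(2 * Real.pi * v))⁻¹
    refine h2.congr_deriv ?_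
    ring
  have hid : Integrable (fun s : ℝ => s) (gaussianReal 0 v) :=
    (memLp_id_gaussianReal (μ := 0) (v := v) 1).integrable (by simp)
  have i1 : Integrable (fun s => s * h s) (gaussianReal 0 v) :=
    hid.mul_bdd (c := M) hhc.aestronglyMeasurable (Filter.Eventually.of_forall hM)
  have i2 : Integrable h' (gaussianReal 0 v) :=
    Integrable.of_bound hc.aestronglyMeasurable M (Filter.Eventually.of_forall hM')
  have i3 : Integrable h (gaussianReal 0 v) :=
    Integrable.of_bound hhc.aestronglyMeasurable M (Filter.Eventually.of_forall hM)
  rw [pdf_integrable_mul hv] at i1 i2 i3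
  have key := integral_mul_deriv_eq_deriv_mul_of_integrable (u := h) (u' := h')
    (v := gaussianPDFReal 0 v) (v' := fun s => -(s / v) * gaussianPDFReal 0 v s)
    (fun s _ => hd s) (fun s _ => hpdf s)
    (by
      convert i1.const_mul (-(1 / (v : ℝ))) using 1
      funext s; simp; ring)
    (by convert i2 using 1; funext s; simp; ring)
    (by convert i3 using 1; funext s; simp; ring)
  have e1 : ∫ s, h s * (-(s / v) * gaussianPDFReal 0 v s) =
      -(1 / (v : ℝ)) * ∫ s, gaussianPDFReal 0 v s • (s * h s) := by
    rw [← integral_const_mul]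
    congr 1; funext s; simp; ring
  have e2 : ∫ s, h' s * gaussianPDFReal 0 v s = ∫ s, gaussianPDFReal 0 v s • h' s := by
    congr 1; funext s; simp; ring
  rw [e1, e2] at key
  field_simp at key
  linarith

section
variable {ι : Type} [Fintype ι] {ν : Measure (ι → ℝ)} {S : ι → ι → ℝ}

def toL (d : ι → ℝ) : (ι → ℝ) →L[ℝ] ℝ :=
  ∑ k, d k • (ContinuousLinearMap.proj (R := ℝ) (φ := fun _ : ι => ℝ) k)

lemma toL_apply (d x : ι → ℝ) : toL d x = ∑ k, d k * x k := by
  simp [toL]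

lemma ibp (h : CG ν S) (j : ι) (hj : 0 < S j j) (F : (ι → ℝ) → ℝ) (dF : ι → (ι → ℝ) → ℝ)
    (hF : ∀ x, HasFDerivAt F (toL (fun k => dF k x)) x) (M : ℝ) (hM : ∀ x, |F x| ≤ M)
    (hdM : ∀ k x, |dF k x| ≤ M) (hc : ∀ k, Continuous (dF k)) :
    ∫ x, x j * F x ∂ν = ∑ k, S j k * ∫ x, dF k x ∂ν := by
  have := h.gauss
  set u : ι → ℝ := fun k => S j k / S j j with hu
  set Φ : (ι → ℝ) → ℝ × (ι → ℝ) := fun x => (x j, fun k => x k - x j * (S j k / S j j)) with hΦ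
  have hΦm : Measurable Φ := by rw [hΦ]; fun_prop
  have hFc : Continuous F := continuous_iff_continuousAt.2 fun x => (hF x).continuousAt
  set ρ := ν.map (fun x k => x k - x j * (S j k / S j j)) with hρ
  have hρp : IsProbabilityMeasure ρ := nzR_prob h j
  have hmap : ν.map Φ = (gaussianReal 0 (S j j).toNNReal).prod ρ := h.decomp j hj.ne'
  have hv : (S j j).toNNReal ≠ 0 := by simpa using hj
  let T : ℝ × (ι → ℝ) → (ι → ℝ) := fun z k => z.2 k + z.1 * u k
  have hTm : Continuous T := by
    show Continuous fun (z : ℝ × (ι → ℝ)) k => z.2 k + z.1 * u k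
    fun_prop
  have hTΦ : ∀ x, T (Φ x) = x := by
    intro x; funext k; simp [T, Φ, u]
  -- left side
  have int1 : Integrable (fun z => z.1 * F (T z)) (ν.map Φ) := by
    rw [integrable_map_measure (Continuous.aestronglyMeasurable (by fun_prop)) hΦm.aemeasurable]
    have e : ((fun z => z.1 * F (T z)) ∘ Φ) = fun x => x j * F x := by
      funext x
      simp only [Function.comp, hTΦ]
      rfl
    rw [e]
    exact (h.integrable j).mul_bdd (c := M) hFc.aestronglyMeasurable (Filter.Eventually.of_forall hM)
  have int2 : Integrable (fun z => ∑ k, u k * dF k (T z)) (ν.map Φ) := by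
    have : IsProbabilityMeasure (ν.map Φ) := Measure.isProbabilityMeasure_map hΦm.aemeasurable
    refine integrable_finsetSum _ fun k _ => Integrable.const_mul ?_ _
    exact Integrable.of_bound (((hc k).comp hTm).aestronglyMeasurable) M
      (Filter.Eventually.of_forall fun z => hdM k _)
  have l1 : ∫ x, x j * F x ∂ν = ∫ z, z.1 * F (T z) ∂(ν.map Φ) := by
    rw [integral_map hΦm.aemeasurable (Continuous.aestronglyMeasurable (by fun_prop))]
    simp only [hTΦ]
    rfl
  have l2 : ∫ x, ∑ k, u k * dF k x ∂ν = ∫ z, ∑ k, u k * dF k (T z) ∂(ν.map Φ) := by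
    have hcc : Continuous fun z => ∑ k, u k * dF k (T z) :=
      continuous_finsetSum _ fun k _ => ((hc k).comp hTm).const_mul _
    rw [integral_map hΦm.aemeasurable hcc.aestronglyMeasurable]
    simp only [hTΦ]
  have l3 : ∫ x, ∑ k, u k * dF k x ∂ν = ∑ k, u k * ∫ x, dF k x ∂ν := by
    rw [integral_finsetSum]
    · simp_rw [integral_const_mul]
    · intro k _
      exact (Integrable.of_bound (hc k).aestronglyMeasurable M
        (Filter.Eventually.of_forall fun z => hdM k _)).const_mul _
  have main : ∫ z, z.1 * F (T z) ∂(ν.map Φ) = S j j * ∫ z, ∑ k, u k * dF k (T z) ∂(ν.map Φ) := by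
    rw [hmap] at int1 int2 ⊢
    rw [integral_prod_symm _ int1, integral_prod_symm _ int2, ← integral_const_mul]
    congr 1; funext r
    have hder : ∀ s, HasDerivAt (fun s => F (T (s, r))) (∑ k, u k * dF k (T (s, r))) s := by
      intro s
      have hT : HasDerivAt (fun s => T (s, r)) u s := by
        rw [hasDerivAt_pi]
        intro k
        simpa [T] using ((hasDerivAt_id s).mul_const (u k)).const_add (r k)
      have := (hF (T (s, r))).comp_hasDerivAt s hT
      rw [toL_apply] at this
      exact this.congr_deriv (Finset.sum_congr rfl fun k _ => mul_comm _ _)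
    have hM0 : 0 ≤ M := (abs_nonneg _).trans (hM 0)
    have := ibp1 hv (fun s => F (T (s, r))) (fun s => ∑ k, u k * dF k (T (s, r))) hder
      (M + ∑ k, |u k| * M) (fun s => (hM _).trans (le_add_of_nonneg_right (by positivity)))
      (fun s => by
        refine (Finset.abs_sum_le_sum_abs _ _).trans ?_
        refine le_trans (Finset.sum_le_sum fun k _ => ?_) (le_add_of_nonneg_left hM0)
        rw [abs_mul]
        gcongr
        exact hdM k _)
      (continuous_finsetSum _ fun k _ => ((hc k).comp (hTm.comp (by fun_prop))).const_mul _)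
    rw [this, Real.coe_toNNReal _ hj.le]
  rw [l1, main, ← l2, l3, Finset.mul_sum]
  refine Finset.sum_congr rfl fun k _ => ?_
  simp only [hu]
  field_simp

/-- Regularity package for the smooth test function. -/
structure Smooth2 (f : (ι → ℝ) → ℝ) (f1 : ι → (ι → ℝ) → ℝ) (f2 : ι → ι → (ι → ℝ) → ℝ) (M : ℝ) :
    Prop where
  d1 : ∀ x, HasFDerivAt f (toL (fun k => f1 k x)) x
  d2 : ∀ j x, HasFDerivAt (f1 j) (toL (fun k => f2 j k x)) x
  b0 : ∀ x, |f x| ≤ M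
  b1 : ∀ j x, |f1 j x| ≤ M
  b2 : ∀ j k x, |f2 j k x| ≤ M
  c2 : ∀ j k, Continuous (f2 j k)

variable {f : (ι → ℝ) → ℝ} {f1 : ι → (ι → ℝ) → ℝ} {f2 : ι → ι → (ι → ℝ) → ℝ} {M : ℝ}

lemma Smooth2.c0 (hf : Smooth2 f f1 f2 M) : Continuous f :=
  continuous_iff_continuousAt.2 fun x => (hf.d1 x).continuousAt

lemma Smooth2.c1 (hf : Smooth2 f f1 f2 M) (j : ι) : Continuous (f1 j) :=
  continuous_iff_continuousAt.2 fun x => (hf.d2 j x).continuousAt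

lemma Smooth2.m0 (hf : Smooth2 f f1 f2 M) : 0 ≤ M := (abs_nonneg _).trans (hf.b0 0)

lemma ibp_prod (h : CG ν S) (j : ι) (hj : 0 < S j j) (ν' : Measure (ι → ℝ)) [IsProbabilityMeasure ν']
    (hf : Smooth2 f f1 f2 M) (a b : ℝ) :
    Integrable (fun z : (ι → ℝ) × (ι → ℝ) => z.1 j * f1 j (a • z.1 + b • z.2)) (ν.prod ν') ∧
    ∫ z, z.1 j * f1 j (a • z.1 + b • z.2) ∂(ν.prod ν') =
      ∑ k, a * S j k * ∫ z, f2 j k (a • z.1 + b • z.2) ∂(ν.prod ν') := by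
  have := h.gauss
  have hc1 := hf.c1 j
  have hI : Integrable (fun z : (ι → ℝ) × (ι → ℝ) => z.1 j * f1 j (a • z.1 + b • z.2)) (ν.prod ν') := by
    refine Integrable.mul_bdd (c := M) ?_ (Continuous.aestronglyMeasurable (by fun_prop))
      (Filter.Eventually.of_forall fun z => hf.b1 j _)
    exact (h.integrable j).comp_fst ν'
  have hI2 : ∀ k, Integrable (fun z : (ι → ℝ) × (ι → ℝ) => f2 j k (a • z.1 + b • z.2)) (ν.prod ν') := by
    intro k
    have := hf.c2 j k
    exact Integrable.of_bound (Continuous.aestronglyMeasurable (by fun_prop)) M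
      (Filter.Eventually.of_forall fun z => hf.b2 j k _)
  refine ⟨hI, ?_⟩
  rw [integral_prod_symm _ hI]
  have inner : ∀ y : ι → ℝ, ∫ x, x j * f1 j (a • x + b • y) ∂ν =
      ∑ k, a * S j k * ∫ x, f2 j k (a • x + b • y) ∂ν := by
    intro y
    have hM0 := hf.m0
    have := ibp h j hj (fun x => f1 j (a • x + b • y)) (fun k x => a * f2 j k (a • x + b • y))
      (fun x => by
        have h1 : HasFDerivAt (fun x : ι → ℝ => a • x + b • y)
            (a • ContinuousLinearMap.id ℝ (ι → ℝ)) x :=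
          ((hasFDerivAt_id x).const_smul a).add_const (b • y)
        have h2 := (hf.d2 j (a • x + b • y)).comp x h1
        refine h2.congr_fderiv ?_
        refine ContinuousLinearMap.ext fun w => ?_
        rw [ContinuousLinearMap.comp_apply, toL_apply, toL_apply]
        refine Finset.sum_congr rfl fun k _ => ?_
        simp
        ring)
      (M + |a| * M) (fun x => (hf.b1 j _).trans (le_add_of_nonneg_right (by positivity)))
      (fun k x => by
        rw [abs_mul]
        refine le_trans ?_ (le_add_of_nonneg_left hM0)
        gcongr
        exact hf.b2 j k _)
      (fun k => by
        have := hf.c2 j k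
        fun_prop)
    rw [this]
    refine Finset.sum_congr rfl fun k _ => ?_
    rw [integral_const_mul]; ring
  simp_rw [inner]
  rw [integral_finsetSum]
  · refine Finset.sum_congr rfl fun k _ => ?_
    rw [integral_const_mul, ← integral_prod_symm _ (hI2 k)]
  · intro k _
    exact (hI2 k).integral_prod_right.const_mul _

lemma interp {νG νV : Measure (ι → ℝ)} {SG SV : ι → ι → ℝ} (hG : CG νG SG) (hV : CG νV SV)
    (pG : ∀ j, 0 < SG j j) (pV : ∀ j, 0 < SV j j) (hf : Smooth2 f f1 f2 M) (B Δ : ℝ)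
    (hB : ∀ x, ∑ j, ∑ k, |f2 j k x| ≤ B) (hΔ : ∀ j k, |SG j k - SV j k| ≤ Δ) (hΔ0 : 0 ≤ Δ) :
    |∫ x, f x ∂νG - ∫ x, f x ∂νV| ≤ Δ * B := by
  have := hG.gauss
  have := hV.gauss
  set μ := νG.prod νV with hμ
  have hc0 := hf.c0
  let Z : ℝ → (ι → ℝ) × (ι → ℝ) → (ι → ℝ) := fun θ z => Real.sin θ • z.1 + Real.cos θ • z.2
  have hZc : ∀ θ, Continuous (Z θ) := by
    intro θ
    show Continuous fun z : (ι → ℝ) × (ι → ℝ) => Real.sin θ • z.1 + Real.cos θ • z.2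
    fun_prop
  let F' : ℝ → (ι → ℝ) × (ι → ℝ) → ℝ := fun θ z =>
    ∑ j, f1 j (Z θ z) * (Real.cos θ * z.1 j - Real.sin θ * z.2 j)
  have hder : ∀ θ, HasDerivAt (fun θ => ∫ z, f (Z θ z) ∂μ) (∫ z, F' θ z ∂μ) θ := by
    intro θ
    refine (hasDerivAt_integral_of_dominated_loc_of_deriv_le (s := Set.univ)
      (bound := fun z => ∑ j, M * (|z.1 j| + |z.2 j|)) Filter.univ_mem
      (Filter.Eventually.of_forall fun θ => (hc0.comp (hZc θ)).aestronglyMeasurable)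
      ?_ ?_ ?_ ?_ ?_).2
    · exact Integrable.of_bound (hc0.comp (hZc θ)).aestronglyMeasurable M
        (Filter.Eventually.of_forall fun z => hf.b0 _)
    · refine Continuous.aestronglyMeasurable (continuous_finsetSum _ fun j _ => ?_)
      exact ((hf.c1 j).comp (hZc θ)).mul (by fun_prop)
    · refine Filter.Eventually.of_forall fun z θ _ => ?_
      refine (Finset.abs_sum_le_sum_abs _ _).trans (Finset.sum_le_sum fun j _ => ?_)
      rw [abs_mul]
      have hM0 := hf.m0
      gcongr
      · exact hf.b1 j _
      · refine (abs_sub _ _).trans ?_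
        rw [abs_mul, abs_mul]
        have a1 := Real.abs_cos_le_one θ
        have a2 := Real.abs_sin_le_one θ
        nlinarith [abs_nonneg (z.1 j), abs_nonneg (z.2 j)]
    · refine integrable_finsetSum _ fun j _ => Integrable.const_mul (Integrable.add ?_ ?_) _
      · exact ((hG.integrable j).comp_fst νV).abs
      · exact ((hV.integrable j).comp_snd νG).abs
    · refine Filter.Eventually.of_forall fun z θ _ => ?_
      have hZ : HasDerivAt (fun θ => Z θ z) (fun j => Real.cos θ * z.1 j - Real.sin θ * z.2 j) θ := by
        rw [hasDerivAt_pi]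
        intro k
        have := ((Real.hasDerivAt_sin θ).mul_const (z.1 k)).add ((Real.hasDerivAt_cos θ).mul_const (z.2 k))
        exact this.congr_deriv (by ring)
      have := (hf.d1 (Z θ z)).comp_hasDerivAt θ hZ
      rw [toL_apply] at this
      exact this
  have hI2 : ∀ θ j k, Integrable (fun z => f2 j k (Z θ z)) μ := fun θ j k =>
    Integrable.of_bound ((hf.c2 j k).comp (hZc θ)).aestronglyMeasurable M
      (Filter.Eventually.of_forall fun z => hf.b2 j k _)
  have hval : ∀ θ, ∫ z, F' θ z ∂μ =
      ∫ z, Real.cos θ * Real.sin θ * ∑ j, ∑ k, (SG j k - SV j k) * f2 j k (Z θ z) ∂μ := by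
    intro θ
    have hg := fun j => ibp_prod hG j (pG j) νV hf (Real.sin θ) (Real.cos θ)
    have hv0 := fun j => ibp_prod hV j (pV j) νG hf (Real.cos θ) (Real.sin θ)
    have hv : ∀ j, Integrable (fun z : (ι → ℝ) × (ι → ℝ) => z.2 j * f1 j (Z θ z)) μ ∧
      ∫ z, z.2 j * f1 j (Z θ z) ∂μ =
        ∑ k, Real.cos θ * SV j k * ∫ z, f2 j k (Z θ z) ∂μ := by
      intro j
      obtain ⟨h1, h2⟩ := hv0 j
      constructor
      · have := h1.swap
        convert this using 1
        funext z
        simp [Z, Function.comp, add_comm]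
      · have sw : ∀ φ : (ι → ℝ) × (ι → ℝ) → ℝ, ∫ z, φ z.swap ∂μ = ∫ z, φ z ∂(νV.prod νG) :=
          fun φ => integral_prod_swap φ
        have t1 := sw (fun z => z.1 j * f1 j (Real.cos θ • z.1 + Real.sin θ • z.2))
        have t2 := fun k => sw (fun z => f2 j k (Real.cos θ • z.1 + Real.sin θ • z.2))
        have hZs : ∀ z, Z θ z = Real.cos θ • z.swap.1 + Real.sin θ • z.swap.2 := fun z => add_comm _ _
        simp only [hZs]
        rw [← t1] at h2
        simp only [← t2] at h2
        exact h2
    have hs : ∫ z, F' θ z ∂μ = ∑ j, (Real.cos θ * ∫ z, z.1 j * f1 j (Z θ z) ∂μ -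
        Real.sin θ * ∫ z, z.2 j * f1 j (Z θ z) ∂μ) := by
      have e : F' θ = fun z => ∑ j, (Real.cos θ * (z.1 j * f1 j (Z θ z)) -
        Real.sin θ * (z.2 j * f1 j (Z θ z))) := by
        funext z
        exact Finset.sum_congr rfl fun j _ => by ring
      rw [e, integral_finsetSum]
      · refine Finset.sum_congr rfl fun j _ => ?_
        rw [integral_sub ((hg j).1.const_mul _) ((hv j).1.const_mul _), integral_const_mul,
          integral_const_mul]
      · intro j _
        exact ((hg j).1.const_mul _).sub ((hv j).1.const_mul _)
    rw [hs, integral_const_mul, integral_finsetSum _ (fun j _ => integrable_finsetSum _ fun k _ =>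
      (hI2 θ j k).const_mul _), Finset.mul_sum]
    refine Finset.sum_congr rfl fun j _ => ?_
    rw [integral_finsetSum _ (fun k _ => (hI2 θ j k).const_mul _), (hv j).2]
    have := (hg j).2
    change ∫ z, z.1 j * f1 j (Z θ z) ∂μ = ∑ k, Real.sin θ * SG j k * ∫ z, f2 j k (Z θ z) ∂μ at this
    rw [this, Finset.mul_sum, Finset.mul_sum, Finset.mul_sum, ← Finset.sum_sub_distrib]
    refine Finset.sum_congr rfl fun k _ => ?_
    rw [integral_const_mul]
    ring
  have hbound : ∀ θ, |∫ z, F' θ z ∂μ| ≤ Δ * B / 2 := by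
    intro θ
    rw [hval]
    have hcs : |Real.cos θ * Real.sin θ| ≤ 1 / 2 := by
      rw [abs_le]
      constructor <;> nlinarith [Real.sin_sq_add_cos_sq θ, sq_nonneg (Real.sin θ + Real.cos θ),
        sq_nonneg (Real.sin θ - Real.cos θ)]
    have := norm_integral_le_of_norm_le_const (μ := μ) (C := Δ * B / 2)
      (f := fun z => Real.cos θ * Real.sin θ * ∑ j, ∑ k, (SG j k - SV j k) * f2 j k (Z θ z))
      (Filter.Eventually.of_forall fun z => by
        rw [Real.norm_eq_abs, abs_mul]
        have : |∑ j, ∑ k, (SG j k - SV j k) * f2 j k (Z θ z)| ≤ Δ * B := by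
          calc _ ≤ ∑ j, ∑ k, Δ * |f2 j k (Z θ z)| := by
                refine (Finset.abs_sum_le_sum_abs _ _).trans (Finset.sum_le_sum fun j _ => ?_)
                refine (Finset.abs_sum_le_sum_abs _ _).trans (Finset.sum_le_sum fun k _ => ?_)
                rw [abs_mul]
                gcongr
                exact hΔ j k
            _ = Δ * ∑ j, ∑ k, |f2 j k (Z θ z)| := by simp_rw [Finset.mul_sum]
            _ ≤ _ := by gcongr; exact hB _
        calc _ ≤ 1 / 2 * (Δ * B) := by gcongr
          _ = _ := by ring)
    simpa using this
  have hmv := Convex.norm_image_sub_le_of_norm_hasDerivWithin_le (s := Set.univ) (C := Δ * B / 2)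
    (f := fun θ => ∫ z, f (Z θ z) ∂μ) (f' := fun θ => ∫ z, F' θ z ∂μ)
    (fun θ _ => (hder θ).hasDerivWithinAt) (fun θ _ => hbound θ) convex_univ
    (Set.mem_univ (0 : ℝ)) (Set.mem_univ (Real.pi / 2))
  have e0 : ∫ z, f (Z 0 z) ∂μ = ∫ x, f x ∂νV := by
    simp only [Z, Real.sin_zero, Real.cos_zero, zero_smul, one_smul, zero_add]
    rw [hμ, integral_fun_snd]; simp
  have e1 : ∫ z, f (Z (Real.pi / 2) z) ∂μ = ∫ x, f x ∂νG := by
    simp only [Z, Real.sin_pi_div_two, Real.cos_pi_div_two, zero_smul, one_smul, add_zero]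
    rw [hμ, integral_fun_fst]; simp
  simp only [e0, e1, Real.norm_eq_abs, sub_zero] at hmv
  refine hmv.trans ?_
  have hB0 : 0 ≤ B := (Finset.sum_nonneg fun j _ => Finset.sum_nonneg fun k _ => abs_nonneg _).trans (hB 0)
  rw [abs_of_pos (by positivity)]
  have := Real.pi_le_four
  nlinarith [mul_nonneg hΔ0 hB0]
end


lemma exists_cutoff : ∃ (g g1 g2 : ℝ → ℝ) (K : ℝ), 0 < K ∧ (∀ s, HasDerivAt g (g1 s) s) ∧
    (∀ s, HasDerivAt g1 (g2 s) s) ∧ Continuous g2 ∧ (∀ s, 0 ≤ g s) ∧ (∀ s, g s ≤ 1) ∧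
    (∀ s, s ≤ 1 → g s = 1) ∧ (∀ s, 2 ≤ s → g s = 0) ∧ (∀ s, |g1 s| ≤ K) ∧ (∀ s, |g2 s| ≤ K) := by
  set g : ℝ → ℝ := fun s => Real.smoothTransition (2 - s) with hg
  have hs : ContDiff ℝ 3 g := Real.smoothTransition.contDiff.comp (contDiff_const.sub contDiff_id)
  have hs1 : ContDiff ℝ 2 (deriv g) := by
    have : ContDiff ℝ (2 + 1) g := by norm_num; exact hs
    exact (contDiff_succ_iff_deriv.1 this).2.2
  have hs2 : ContDiff ℝ 1 (deriv (deriv g)) := by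
    have : ContDiff ℝ (1 + 1) (deriv g) := by norm_num; exact hs1
    exact (contDiff_succ_iff_deriv.1 this).2.2
  have h1 : ∀ s, s ≤ 1 → g s = 1 := fun s h => Real.smoothTransition.one_of_one_le (by linarith)
  have h2 : ∀ s, 2 ≤ s → g s = 0 := fun s h => Real.smoothTransition.zero_of_nonpos (by linarith)
  have hsup : HasCompactSupport (deriv g) := by
    refine HasCompactSupport.intro (isCompact_Icc (a := (1 : ℝ)) (b := 2)) fun s hs => ?_
    rw [Set.mem_Icc, not_and_or, not_le, not_le] at hs
    rcases hs with hs | hs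
    · have : g =ᶠ[nhds s] fun _ => 1 := by
        filter_upwards [Iio_mem_nhds hs] with t ht using h1 t (le_of_lt ht)
      rw [this.deriv_eq]; simp
    · have : g =ᶠ[nhds s] fun _ => 0 := by
        filter_upwards [Ioi_mem_nhds hs] with t ht using h2 t (le_of_lt ht)
      rw [this.deriv_eq]; simp
  obtain ⟨K1, hK1⟩ := hs1.continuous.bounded_above_of_compact_support hsup
  obtain ⟨K2, hK2⟩ := hs2.continuous.bounded_above_of_compact_support hsup.deriv
  refine ⟨g, deriv g, deriv (deriv g), |K1| + |K2| + 1, by positivity,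
    fun s => (hs.differentiable (by norm_num) s).hasDerivAt,
    fun s => (hs1.differentiable (by norm_num) s).hasDerivAt, hs2.continuous,
    fun s => Real.smoothTransition.nonneg _, fun s => Real.smoothTransition.le_one _, h1, h2,
    fun s => ?_, fun s => ?_⟩
  · have := hK1 s
    rw [Real.norm_eq_abs] at this
    linarith [le_abs_self K1, abs_nonneg K2]
  · have := hK2 s
    rw [Real.norm_eq_abs] at this
    linarith [le_abs_self K2, abs_nonneg K1]

section
open Classical
variable {ι : Type} [Fintype ι]

def smE (β : ℝ) (c : ι → ℝ) (i : ι) (x : ι → ℝ) : ℝ := Real.exp (β * (x i - c i))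
def smS (β : ℝ) (c : ι → ℝ) (x : ι → ℝ) : ℝ := ∑ i, smE β c i x
def smP (β : ℝ) (c : ι → ℝ) (i : ι) (x : ι → ℝ) : ℝ := Real.exp (β * (x i - c i) - Real.log (smS β c x))
/-- scaled log-sum-exp -/
def smM (ε L : ℝ) (c : ι → ℝ) (x : ι → ℝ) : ℝ := L⁻¹ * Real.log (smS (L / ε) c x)

lemma smS_pos [Nonempty ι] (β : ℝ) (c x : ι → ℝ) : 0 < smS β c x :=
  Finset.sum_pos (fun _ _ => Real.exp_pos _) Finset.univ_nonempty

lemma smP_pos (β : ℝ) (c : ι → ℝ) (i x) : 0 < smP β c i x := Real.exp_pos _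

lemma smP_eq [Nonempty ι] (β : ℝ) (c : ι → ℝ) (i x) : smP β c i x = smE β c i x / smS β c x := by
  rw [smP, Real.exp_sub, Real.exp_log (smS_pos β c x), smE]

lemma smP_sum [Nonempty ι] (β : ℝ) (c x : ι → ℝ) : ∑ i, smP β c i x = 1 := by
  simp_rw [smP_eq]
  rw [← Finset.sum_div]
  exact div_self (smS_pos β c x).ne'

lemma smP_le_one [Nonempty ι] (β : ℝ) (c : ι → ℝ) (i x) : smP β c i x ≤ 1 := by
  rw [← smP_sum β c x]
  exact Finset.single_le_sum (f := fun i => smP β c i x) (fun i _ => (smP_pos β c i x).le) (Finset.mem_univ i)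

lemma hasFDerivAt_coord (β : ℝ) (c : ι → ℝ) (i : ι) (x : ι → ℝ) :
    HasFDerivAt (fun x : ι → ℝ => β * (x i - c i)) (toL (fun k => β * if i = k then 1 else 0)) x := by
  have h1 := (((ContinuousLinearMap.proj (R := ℝ) (φ := fun _ : ι => ℝ) i).hasFDerivAt (x := x)).sub_const (c i)).const_mul β
  refine h1.congr_fderiv ?_
  refine ContinuousLinearMap.ext fun w => ?_
  rw [toL_apply]
  simp

lemma hasFDerivAt_smS (β : ℝ) (c : ι → ℝ) (x : ι → ℝ) :
    HasFDerivAt (smS β c) (toL (fun k => β * smE β c k x)) x := by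
  have h1 := HasFDerivAt.fun_sum (u := Finset.univ) fun i _ => (hasFDerivAt_coord β c i x).exp
  refine h1.congr_fderiv ?_
  refine ContinuousLinearMap.ext fun w => ?_
  rw [toL_apply]
  simp only [ContinuousLinearMap.sum_apply, ContinuousLinearMap.smul_apply, toL_apply, smE]
  refine Finset.sum_congr rfl fun k _ => ?_
  simp
  ring

lemma hasFDerivAt_log [Nonempty ι] (β : ℝ) (c : ι → ℝ) (x : ι → ℝ) :
    HasFDerivAt (fun x => Real.log (smS β c x)) (toL (fun k => β * smP β c k x)) x := by
  refine ((hasFDerivAt_smS β c x).log (smS_pos β c x).ne').congr_fderiv ?_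
  refine ContinuousLinearMap.ext fun w => ?_
  simp only [ContinuousLinearMap.smul_apply, toL_apply, smP_eq, smul_eq_mul, Finset.mul_sum]
  refine Finset.sum_congr rfl fun k _ => ?_
  ring

lemma hasFDerivAt_smP [Nonempty ι] (β : ℝ) (c : ι → ℝ) (i : ι) (x : ι → ℝ) :
    HasFDerivAt (smP β c i) (toL (fun k => β * smP β c i x * ((if i = k then 1 else 0) - smP β c k x))) x := by
  refine ((hasFDerivAt_coord β c i x).sub (hasFDerivAt_log β c x)).exp.congr_fderiv ?_
  refine ContinuousLinearMap.ext fun w => ?_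
  simp only [ContinuousLinearMap.smul_apply, ContinuousLinearMap.sub_apply, toL_apply, smul_eq_mul, ← Finset.sum_sub_distrib, Finset.mul_sum]
  refine Finset.sum_congr rfl fun k _ => ?_
  simp only [smP, Pi.sub_apply]
  ring

lemma hasFDerivAt_smM [Nonempty ι] {ε L : ℝ} (hL : L ≠ 0) (c : ι → ℝ) (x : ι → ℝ) :
    HasFDerivAt (smM ε L c) (toL (fun k => smP (L / ε) c k x / ε)) x := by
  refine ((hasFDerivAt_log (L / ε) c x).const_mul L⁻¹).congr_fderiv ?_
  refine ContinuousLinearMap.ext fun w => ?_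
  simp only [ContinuousLinearMap.smul_apply, toL_apply, smul_eq_mul, Finset.mul_sum]
  refine Finset.sum_congr rfl fun k _ => ?_
  field_simp

lemma smM_le [Nonempty ι] {ε L : ℝ} (hL : 1 ≤ L) (hε : 0 < ε) (hn : (Fintype.card ι : ℝ) ≤ Real.exp L)
    (c x : ι → ℝ) (h : ∀ i, x i ≤ c i) : smM ε L c x ≤ 1 := by
  have hL0 : 0 < L := by linarith
  rw [smM, inv_mul_le_iff₀ hL0, mul_one, Real.log_le_iff_le_exp (smS_pos _ _ _)]
  refine le_trans ?_ hn
  calc smS (L / ε) c x ≤ ∑ _i : ι, (1 : ℝ) := by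
        refine Finset.sum_le_sum fun i _ => ?_
        rw [smE, Real.exp_le_one_iff]
        exact mul_nonpos_of_nonneg_of_nonpos (by positivity) (by linarith [h i])
    _ = _ := by simp

lemma le_smM [Nonempty ι] {ε L : ℝ} (hL : 1 ≤ L) (hε : 0 < ε)
    (c x : ι → ℝ) (h : ¬ ∀ i, x i ≤ c i + 2 * ε) : 2 ≤ smM ε L c x := by
  have hL0 : 0 < L := by linarith
  push Not at h
  obtain ⟨i, hi⟩ := h
  rw [smM, le_inv_mul_iff₀ hL0, Real.le_log_iff_exp_le (smS_pos _ _ _)]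
  calc Real.exp (L * 2) ≤ smE (L / ε) c i x := by
        rw [smE]
        apply Real.exp_le_exp.2
        rw [div_mul_eq_mul_div, le_div_iff₀ hε]
        nlinarith
    _ ≤ _ := Finset.single_le_sum (f := fun i => smE (L / ε) c i x) (fun i _ => (Real.exp_pos _).le) (Finset.mem_univ i)

lemma exists_smooth : ∃ K : ℝ, 0 < K ∧ ∀ (ι : Type) [Fintype ι] [Nonempty ι] (c : ι → ℝ) (ε L : ℝ),
    0 < ε → 1 ≤ L → (Fintype.card ι : ℝ) ≤ Real.exp L →
    ∃ (f : (ι → ℝ) → ℝ) (f1 : ι → (ι → ℝ) → ℝ) (f2 : ι → ι → (ι → ℝ) → ℝ) (M : ℝ),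
      Smooth2 f f1 f2 M ∧ (∀ x, ∑ j, ∑ k, |f2 j k x| ≤ K * L / ε ^ 2) ∧
      (∀ x, 0 ≤ f x) ∧ (∀ x, f x ≤ 1) ∧ (∀ x, (∀ i, x i ≤ c i) → f x = 1) ∧
      (∀ x, (¬ ∀ i, x i ≤ c i + 2 * ε) → f x = 0) := by
  obtain ⟨g, g1, g2, K, hK, hg, hg1, hg2, h0, h1, h2, h3, b1, b2⟩ := exists_cutoff
  refine ⟨3 * K, by positivity, ?_⟩
  intro ι _ _ c ε L hε hL hn
  have hL0 : 0 < L := by linarith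
  set m := smM ε L c
  set P := smP (L / ε) c
  set f1 : ι → (ι → ℝ) → ℝ := fun j x => g1 (m x) * (P j x / ε) with hf1
  set f2 : ι → ι → (ι → ℝ) → ℝ := fun j k x => g2 (m x) * (P k x / ε) * (P j x / ε) +
    g1 (m x) * (L / ε * P j x * ((if j = k then 1 else 0) - P k x) / ε) with hf2
  have hP0 : ∀ j x, 0 ≤ P j x := fun j x => (smP_pos _ _ _ _).le
  have hP1 : ∀ j x, P j x ≤ 1 := fun j x => smP_le_one _ _ _ _
  have hPs : ∀ x, ∑ j, P j x = 1 := fun x => smP_sum _ _ _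
  have hB : ∀ x, ∑ j, ∑ k, |f2 j k x| ≤ 3 * K * L / ε ^ 2 := by
    intro x
    have hb : ∀ j k, |f2 j k x| ≤ K / ε ^ 2 * (P j x * P k x) + K * L / ε ^ 2 * (P j x * ((if j = k then 1 else 0) + P k x)) := by
      intro j k
      refine (abs_add_le _ _).trans (add_le_add ?_ ?_)
      · rw [abs_mul, abs_mul, abs_of_nonneg (div_nonneg (hP0 k x) hε.le), abs_of_nonneg (div_nonneg (hP0 j x) hε.le)]
        calc _ ≤ K * (P k x / ε) * (P j x / ε) := by
              have := hP0 j x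
              have := hP0 k x
              gcongr; exact b2 _
          _ = _ := by ring
      · have e : |L / ε * P j x * ((if j = k then 1 else 0) - P k x) / ε| ≤ L / ε ^ 2 * (P j x * ((if j = k then 1 else 0) + P k x)) := by
          rw [abs_div, abs_mul, abs_mul, abs_of_pos hε, abs_of_nonneg (hP0 j x), abs_of_pos (div_pos hL0 hε)]
          have : |(if j = k then (1 : ℝ) else 0) - P k x| ≤ (if j = k then 1 else 0) + P k x := by
            refine (abs_sub _ _).trans ?_
            rw [abs_of_nonneg (hP0 k x)]
            gcongr
            split_ifs <;> simp
          have := hP0 j x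
          calc _ ≤ L / ε * P j x * ((if j = k then 1 else 0) + P k x) / ε := by gcongr
            _ = _ := by ring
        rw [abs_mul]
        calc _ ≤ K * (L / ε ^ 2 * (P j x * ((if j = k then 1 else 0) + P k x))) := by
              gcongr; exact b1 _
          _ = _ := by ring
    calc _ ≤ ∑ j, ∑ k, (K / ε ^ 2 * (P j x * P k x) + K * L / ε ^ 2 * (P j x * ((if j = k then 1 else 0) + P k x))) :=
          Finset.sum_le_sum fun j _ => Finset.sum_le_sum fun k _ => hb j k
      _ = K / ε ^ 2 + 2 * (K * L / ε ^ 2) := by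
          simp only [Finset.sum_add_distrib, ← Finset.mul_sum, hPs, mul_add, ← Finset.sum_mul, Finset.sum_ite_eq, Finset.mem_univ, if_true]
          ring_nf
      _ ≤ _ := by
          have : K / ε ^ 2 ≤ K * L / ε ^ 2 := by
            gcongr; nlinarith
          calc _ ≤ K * L / ε ^ 2 + 2 * (K * L / ε ^ 2) := by linarith
            _ = _ := by ring
  have hmd : ∀ x, HasFDerivAt m (toL (fun k => P k x / ε)) x := fun x => hasFDerivAt_smM hL0.ne' c x
  have hPd : ∀ j x, HasFDerivAt (P j) (toL (fun k => L / ε * P j x * ((if j = k then 1 else 0) - P k x))) x :=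
    fun j x => hasFDerivAt_smP _ c j x
  have hmc : Continuous m := continuous_iff_continuousAt.2 fun x => (hmd x).continuousAt
  have hPc : ∀ j, Continuous (P j) := fun j => continuous_iff_continuousAt.2 fun x => (hPd j x).continuousAt
  have hg1c : Continuous g1 := continuous_iff_continuousAt.2 fun x => (hg1 x).continuousAt
  refine ⟨fun x => g (m x), f1, f2, 1 + K / ε + 3 * K * L / ε ^ 2, ⟨?_, ?_, ?_, ?_, ?_, ?_⟩, hB,
    fun x => h0 _, fun x => h1 _, fun x hx => h2 _ (smM_le hL hε hn c x hx),
    fun x hx => h3 _ (le_smM hL hε c x hx)⟩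
  · intro x
    refine ((hg (m x)).comp_hasFDerivAt x (hmd x)).congr_fderiv ?_
    refine ContinuousLinearMap.ext fun w => ?_
    simp only [ContinuousLinearMap.smul_apply, toL_apply, smul_eq_mul, Finset.mul_sum, hf1]
    exact Finset.sum_congr rfl fun k _ => by ring
  · intro j x
    have t1 := (hg1 (m x)).comp_hasFDerivAt x (hmd x)
    have t2 := (hPd j x).mul_const ε⁻¹
    refine (t1.mul t2).congr_fderiv ?_
    refine ContinuousLinearMap.ext fun w => ?_
    simp only [ContinuousLinearMap.smul_apply, ContinuousLinearMap.add_apply, toL_apply, smul_eq_mul, Finset.mul_sum, hf2, ← Finset.sum_add_distrib, Function.comp]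
    exact Finset.sum_congr rfl fun k _ => by ring
  · intro x
    rw [abs_of_nonneg (h0 _)]
    have : 0 ≤ K / ε + 3 * K * L / ε ^ 2 := by positivity
    linarith [h1 (m x)]
  · intro j x
    rw [hf1, abs_mul, abs_of_nonneg (div_nonneg (hP0 j x) hε.le)]
    have : |g1 (m x)| * (P j x / ε) ≤ K * (1 / ε) := by
      have := hP0 j x
      gcongr
      · exact b1 _
      · exact hP1 j x
    have : 0 ≤ 3 * K * L / ε ^ 2 := by positivity
    have : K * (1 / ε) = K / ε := by ring
    linarith
  · intro j k x
    have := hB x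
    have t1 : |f2 j k x| ≤ ∑ k, |f2 j k x| := Finset.single_le_sum (f := fun k => |f2 j k x|) (fun i _ => abs_nonneg _) (Finset.mem_univ k)
    have t2 : ∑ k, |f2 j k x| ≤ ∑ j, ∑ k, |f2 j k x| := Finset.single_le_sum (f := fun j => ∑ k, |f2 j k x|) (fun i _ => Finset.sum_nonneg fun _ _ => abs_nonneg _) (Finset.mem_univ j)
    have : 0 ≤ K / ε := by positivity
    linarith
  · intro j k
    simp only [hf2]
    have := hPc j
    have := hPc k
    fun_prop
end


lemma orthant_one {K : ℝ} {ι : Type} [Fintype ι] [Nonempty ι] {νG νV : Measure (ι → ℝ)} {SG SV : ι → ι → ℝ}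
    (hG : CG νG SG) (hV : CG νV SV) (σ : ℝ) (hσ : 0 < σ)
    (hSG : ∀ i, σ ^ 2 ≤ SG i i) (hSV : ∀ i, σ ^ 2 ≤ SV i i) (L : ℝ) (hL : 1 ≤ L)
    (hn : (Fintype.card ι : ℝ) ≤ Real.exp L) (Δ : ℝ) (hΔ0 : 0 ≤ Δ)
    (hΔ : ∀ j k, |SG j k - SV j k| ≤ Δ) (c : ι → ℝ) (ε : ℝ) (hε : 0 < ε)
    (f : (ι → ℝ) → ℝ) (f1 : ι → (ι → ℝ) → ℝ) (f2 : ι → ι → (ι → ℝ) → ℝ) (M : ℝ)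
    (hf : Smooth2 f f1 f2 M) (hB : ∀ x, ∑ j, ∑ k, |f2 j k x| ≤ K * L / ε ^ 2)
    (h0 : ∀ x, 0 ≤ f x) (h1 : ∀ x, f x ≤ 1) (h2 : ∀ x, (∀ i, x i ≤ c i) → f x = 1)
    (h3 : ∀ x, (¬ ∀ i, x i ≤ c i + 2 * ε) → f x = 0) :
    νG.real {x | ∀ i, x i ≤ c i} ≤ νV.real {x | ∀ i, x i ≤ c i} +
      (20 * √L * (ε / σ) + Δ * (K * L / ε ^ 2)) := by
  have := hG.gauss
  have := hV.gauss
  have hm : ∀ c : ι → ℝ, MeasurableSet {x : ι → ℝ | ∀ i, x i ≤ c i} := by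
    intro c
    have : {x : ι → ℝ | ∀ i, x i ≤ c i} = ⋂ i, {x | x i ≤ c i} := by ext; simp
    rw [this]
    exact MeasurableSet.iInter fun i => measurableSet_le (measurable_pi_apply i) measurable_const
  have hi : ∀ ν : Measure (ι → ℝ), IsProbabilityMeasure ν → Integrable f ν := fun ν _ =>
    Integrable.of_bound hf.c0.aestronglyMeasurable M (Filter.Eventually.of_forall hf.b0)
  have s1 : νG.real {x | ∀ i, x i ≤ c i} ≤ ∫ x, f x ∂νG := by
    rw [← integral_indicator_one (hm c)]
    refine integral_mono ((integrable_const (1 : ℝ)).indicator (hm c)) (hi νG inferInstance) fun x => ?_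
    by_cases hx : x ∈ {x : ι → ℝ | ∀ i, x i ≤ c i}
    · rw [Set.indicator_of_mem hx, h2 x hx]; simp
    · rw [Set.indicator_of_notMem hx]; exact h0 x
  have s2 : ∫ x, f x ∂νV ≤ νV.real {x | ∀ i, x i ≤ c i + 2 * ε} := by
    rw [← integral_indicator_one (hm fun i => c i + 2 * ε)]
    refine integral_mono (hi νV inferInstance) ((integrable_const (1 : ℝ)).indicator (hm fun i => c i + 2 * ε)) fun x => ?_
    by_cases hx : x ∈ {x : ι → ℝ | ∀ i, x i ≤ c i + 2 * ε}
    · rw [Set.indicator_of_mem hx]; exact h1 x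
    · rw [Set.indicator_of_notMem hx, h3 x hx]
  have s3 := interp hG hV (fun j => lt_of_lt_of_le (by positivity) (hSG j))
    (fun j => lt_of_lt_of_le (by positivity) (hSV j)) hf _ Δ hB hΔ hΔ0
  have s4 := nazarov hV σ hσ hSV c L hL hn (2 * ε) (by positivity)
  have s5 := (abs_le.1 s3).2
  have : 10 * √L * (2 * ε / σ) = 20 * √L * (ε / σ) := by ring
  linarith

lemma orthant (σ : ℝ) (hσ : 0 < σ) : ∃ C : ℝ, 0 < C ∧ ∀ (ι : Type) [Fintype ι]
    (νG νV : Measure (ι → ℝ)) (SG SV : ι → ι → ℝ), CG νG SG → CG νV SV →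
    (∀ i, σ ^ 2 ≤ SG i i) → (∀ i, σ ^ 2 ≤ SV i i) → ∀ L : ℝ, 1 ≤ L →
    (Fintype.card ι : ℝ) ≤ Real.exp L → ∀ Δ : ℝ, 0 ≤ Δ → (∀ j k, |SG j k - SV j k| ≤ Δ) →
    ∀ c : ι → ℝ, |νG.real {x | ∀ i, x i ≤ c i} - νV.real {x | ∀ i, x i ≤ c i}| ≤
      C * Δ ^ ((1 : ℝ) / 3) * L ^ ((2 : ℝ) / 3) := by
  obtain ⟨K, hK, hsm⟩ := exists_smooth
  refine ⟨20 / σ + K, by positivity, ?_⟩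
  intro ι _ νG νV SG SV hG hV hSG hSV L hL hn Δ hΔ0 hΔ c
  have := hG.gauss
  have := hV.gauss
  have hL0 : 0 < L := by linarith
  rcases isEmpty_or_nonempty ι with hι | hι
  · have : {x : ι → ℝ | ∀ i, x i ≤ c i} = Set.univ := by ext; simp
    rw [this]
    simp
    positivity
  have key : ∀ ε, 0 < ε → |νG.real {x | ∀ i, x i ≤ c i} - νV.real {x | ∀ i, x i ≤ c i}| ≤
      20 * √L * (ε / σ) + Δ * (K * L / ε ^ 2) := by
    intro ε hε
    obtain ⟨f, f1, f2, M, hf, hB, h0, h1, h2, h3⟩ := hsm ι c ε L hε hL hn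
    have t1 := orthant_one hG hV σ hσ hSG hSV L hL hn Δ hΔ0 hΔ c ε hε f f1 f2 M hf hB h0 h1 h2 h3
    have t2 := orthant_one hV hG σ hσ hSV hSG L hL hn Δ hΔ0
      (fun j k => by rw [abs_sub_comm]; exact hΔ j k) c ε hε f f1 f2 M hf hB h0 h1 h2 h3
    rw [abs_le]
    constructor <;> linarith
  rcases hΔ0.eq_or_lt with rfl | hpos
  · rw [Real.zero_rpow (by norm_num), mul_zero, zero_mul]
    refine le_of_forall_pos_le_add fun δ hδ => ?_
    have hs : 0 < √L := Real.sqrt_pos.2 hL0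
    have := key (δ * σ / (20 * √L)) (by positivity)
    refine this.trans (le_of_eq ?_)
    field_simp
    ring
  · have := key (Δ ^ ((1 : ℝ) / 3) * L ^ ((1 : ℝ) / 6)) (by positivity)
    refine this.trans (le_of_eq ?_)
    have e1 : √L * L ^ ((1 : ℝ) / 6) = L ^ ((2 : ℝ) / 3) := by
      rw [Real.sqrt_eq_rpow, ← Real.rpow_add hL0]; norm_num
    have e2 : Δ = Δ ^ ((1 : ℝ) / 3) * (Δ ^ ((1 : ℝ) / 3)) ^ 2 := by
      rw [← Real.rpow_natCast, ← Real.rpow_mul hΔ0, ← Real.rpow_add hpos]; norm_num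
    have e3 : L = L ^ ((2 : ℝ) / 3) * (L ^ ((1 : ℝ) / 6)) ^ 2 := by
      rw [← Real.rpow_natCast, ← Real.rpow_mul hL0.le, ← Real.rpow_add hL0]; norm_num
    have p1 : 0 < Δ ^ ((1 : ℝ) / 3) := by positivity
    have p2 : 0 < L ^ ((1 : ℝ) / 6) := by positivity
    generalize Δ ^ ((1 : ℝ) / 3) = d at *
    generalize L ^ ((1 : ℝ) / 6) = l at *
    generalize L ^ ((2 : ℝ) / 3) = m at *
    have e4 : Δ * (K * L / (d * l) ^ 2) = K * d * m := by
      rw [e2, e3]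
      field_simp
    rw [e4]
    calc 20 * √L * (d * l / σ) + K * d * m = 20 / σ * d * (√L * l) + K * d * m := by ring
      _ = _ := by rw [e1]; ring


def rI {p : ℕ} (a b : Fin p → EReal) : Type :=
  {q : Fin p × Bool // (q.2 = true → b q.1 ≠ ⊤) ∧ (q.2 = false → a q.1 ≠ ⊥)}

open Classical in
instance rI_fintype {p : ℕ} (a b : Fin p → EReal) : Fintype (rI a b) := by
  unfold rI; infer_instance

def rS {p : ℕ} {a b : Fin p → EReal} (q : rI a b) : ℝ := if q.1.2 then 1 else -1
def rC {p : ℕ} {a b : Fin p → EReal} (q : rI a b) : ℝ :=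
  if q.1.2 then (b q.1.1).toReal else -(a q.1.1).toReal

lemma rI_card {p : ℕ} (a b : Fin p → EReal) : (Fintype.card (rI a b)) ≤ 2 * p := by
  have : Fintype.card (rI a b) ≤ Fintype.card (Fin p × Bool) :=
    Fintype.card_le_of_injective (fun q => q.1) Subtype.val_injective
  simpa [mul_comm] using this

lemma rect_eq {p : ℕ} (a b : Fin p → EReal) (ha : ∀ j, a j ≠ ⊤) (hb : ∀ j, b j ≠ ⊥) :
    gaussRect a b = (fun (x : Fin p → ℝ) (q : rI a b) => rS q * x q.1.1) ⁻¹' {y | ∀ q, y q ≤ rC q} := by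
  ext x
  simp only [gaussRect, Set.mem_preimage, Set.mem_ofPred_eq]
  constructor
  · rintro h ⟨⟨j, t⟩, h1, h2⟩
    cases t
    · have h3 := h2 rfl
      have h4 := (h j).1
      simp only [rS, rC]
      have : (a j).toReal ≤ x j := by
        rw [← EReal.coe_toReal (ha j) h3] at h4
        exact_mod_cast h4
      simpa using this
    · have h3 := h1 rfl
      have h4 := (h j).2
      have : x j ≤ (b j).toReal := by
        rw [← EReal.coe_toReal h3 (hb j)] at h4
        exact_mod_cast h4
      simpa [rS, rC] using this
  · intro h j
    constructor
    · by_cases h3 : a j = ⊥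
      · rw [h3]; exact bot_le
      · have := h ⟨(j, false), by simp, fun _ => h3⟩
        have : (a j).toReal ≤ x j := by simpa [rS, rC] using this
        rw [← EReal.coe_toReal (ha j) h3]
        exact_mod_cast this
    · by_cases h3 : b j = ⊤
      · rw [h3]; exact le_top
      · have := h ⟨(j, true), fun _ => h3, by simp⟩
        have : x j ≤ (b j).toReal := by simpa [rS, rC] using this
        rw [← EReal.coe_toReal h3 (hb j)]
        exact_mod_cast this

theorem gaussian_comparison_rectangles (σ : ℝ) (hσ : 0 < σ) :
    ∃ C > (0 : ℝ), ∀ (p : ℕ), 2 ≤ p →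
      ∀ (νG νV : Measure (Fin p → ℝ)) (SG SV : Fin p → Fin p → ℝ),
        IsCenteredGaussianCov νG SG → IsCenteredGaussianCov νV SV →
        (∀ j, σ ^ 2 ≤ SG j j) → (∀ j, σ ^ 2 ≤ SV j j) →
        ∀ a b : Fin p → EReal,
          |(νG (gaussRect a b)).toReal - (νV (gaussRect a b)).toReal|
            ≤ C * (⨆ j, ⨆ k, |SG j k - SV j k|) ^ ((1 : ℝ) / 3) *
                Real.log p ^ ((2 : ℝ) / 3) := by
  obtain ⟨C, hC, hmain⟩ := orthant σ hσ
  refine ⟨C * 2 ^ ((2 : ℝ) / 3), by positivity, ?_⟩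
  intro p hp νG νV SG SV hG hV hSG hSV a b
  have hp2 : (2 : ℝ) ≤ p := by exact_mod_cast hp
  have hlog : 0 ≤ Real.log p := Real.log_nonneg (by linarith)
  have hle : ∀ j k, |SG j k - SV j k| ≤ ⨆ j, ⨆ k, |SG j k - SV j k| := fun j k =>
    (le_ciSup (f := fun k => |SG j k - SV j k|) (Set.finite_range _).bddAbove k).trans
      (le_ciSup (f := fun j => ⨆ k, |SG j k - SV j k|) (Set.finite_range _).bddAbove j)
  set Δ := ⨆ j, ⨆ k, |SG j k - SV j k|
  have hΔ0 : 0 ≤ Δ := (abs_nonneg _).trans (hle ⟨0, by omega⟩ ⟨0, by omega⟩)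
  by_cases hne : (∀ j, a j ≠ ⊤) ∧ (∀ j, b j ≠ ⊥)
  swap
  · have : gaussRect a b = ∅ := by
      ext x
      simp only [gaussRect, Set.mem_ofPred_eq, Set.mem_empty_iff_false, iff_false]
      intro h
      refine hne ⟨fun j hj => ?_, fun j hj => ?_⟩
      · have := (h j).1; rw [hj] at this; simp at this
      · have := (h j).2; rw [hj] at this; simp at this
    rw [this]
    simp
    positivity
  have hσ2 : 0 < σ ^ 2 := by positivity
  have cG := (cg_of_isCenteredGaussianCov hG fun j => lt_of_lt_of_le hσ2 (hSG j)).push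
    (rS (a := a) (b := b)) (fun q => q.1.1)
  have cV := (cg_of_isCenteredGaussianCov hV fun j => lt_of_lt_of_le hσ2 (hSV j)).push
    (rS (a := a) (b := b)) (fun q => q.1.1)
  have hss : ∀ q : rI a b, rS q * rS q = 1 := by
    intro q; unfold rS; split_ifs <;> norm_num
  have has : ∀ q : rI a b, |rS q| = 1 := by
    intro q; unfold rS; split_ifs <;> norm_num
  have hL4 : Real.log 4 = 2 * Real.log 2 := by
    rw [show (4 : ℝ) = 2 ^ 2 by norm_num, Real.log_pow]; norm_num
  have hL : 1 ≤ Real.log (2 * p) := by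
    have : Real.log 4 ≤ Real.log (2 * p) := Real.log_le_log (by norm_num) (by linarith)
    linarith [Real.log_two_gt_d9]
  have hcard : (Fintype.card (rI a b) : ℝ) ≤ Real.exp (Real.log (2 * p)) := by
    rw [Real.exp_log (by linarith)]
    exact_mod_cast rI_card a b
  have key := hmain (rI a b) _ _ _ _ cG cV
    (fun q => by have := hSG q.1.1; rw [hss]; linarith)
    (fun q => by have := hSV q.1.1; rw [hss]; linarith)
    (Real.log (2 * p)) hL hcard Δ hΔ0
    (fun q r => by
      rw [← mul_sub, abs_mul, abs_mul, has, has, one_mul, one_mul]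
      have h1 := abs_le.1 (hle q.1.1 r.1.1)
      have h2 := abs_le.1 (hle r.1.1 q.1.1)
      rw [abs_le]
      constructor <;> linarith) rC
  have hm : MeasurableSet {y : rI a b → ℝ | ∀ q, y q ≤ rC q} := by
    have : {x : rI a b → ℝ | ∀ i, x i ≤ rC i} = ⋂ i, {x | x i ≤ rC i} := by ext; simp
    rw [this]
    exact MeasurableSet.iInter fun i => measurableSet_le (measurable_pi_apply i) measurable_const
  have hT : Measurable (fun (x : Fin p → ℝ) (q : rI a b) => rS q * x q.1.1) := by fun_prop
  rw [map_measureReal_apply hT hm, map_measureReal_apply hT hm, ← rect_eq a b hne.1 hne.2] at key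
  refine key.trans ?_
  have hlog2 : Real.log (2 * p) ≤ 2 * Real.log p := by
    rw [Real.log_mul (by norm_num) (by linarith)]
    have := Real.log_le_log (by norm_num) hp2
    linarith
  calc C * Δ ^ ((1 : ℝ) / 3) * Real.log (2 * p) ^ ((2 : ℝ) / 3)
      ≤ C * Δ ^ ((1 : ℝ) / 3) * (2 * Real.log p) ^ ((2 : ℝ) / 3) := by gcongr
    _ = _ := by rw [Real.mul_rpow (by norm_num) hlog]; ring
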